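/- arXiv:1907.13094 — 4 statements merged into one kernel-verified Lean document; each statement's English description precedes it below -/
import Mathlib

section
/- For distinct positive integers i and j with |i − j| ≥ 2, the box removing operators commute: 𝔡_i 𝔡_j = 𝔡_j 𝔡_i as operators on weak compositions. -/
namespace CompOps

/-- Subtract 1 from the rightmost part equal to `i`; `none` if no part equals `i`. -/
def removeAux (i : ℕ) : List ℕ → Option (List ℕ)
  | [] => none
  | x :: xs =>
    match removeAux i xs with
    | some ys => some (x :: ys)
    | none => if x = i then some ((i - 1) :: xs) else none

/-- The box removing operator `𝔡ᵢ`, acting on weak compositions together with a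
formal zero (`none`); `𝔡₀` is the identity. -/
def d : ℕ → Option (List ℕ) → Option (List ℕ)
  | 0, o => o
  | i + 1, o => o.bind (removeAux (i + 1))

/-- The appending operator `aᵢ`, appending a part `i` at the end. -/
def a (i : ℕ) : Option (List ℕ) → Option (List ℕ) :=
  Option.map (fun l => l ++ [i])

/-- `𝔡_I` for a finite set `I = {i₁ < ⋯ < i_k}`: the composite
`𝔡_{i₁}𝔡_{i₂}⋯𝔡_{i_k}`, where `𝔡_{i_k}` (the largest index) acts first. -/
def dSet (I : Finset ℕ) : Option (List ℕ) → Option (List ℕ) :=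
  (I.sort (· ≤ ·)).foldr (fun i f => d i ∘ f) id

/-- The jdt operator `𝔲ᵢ = aᵢ 𝔡_{[i-1]}` (with `𝔲₀` the identity). -/
def u : ℕ → Option (List ℕ) → Option (List ℕ)
  | 0 => id
  | i + 1 => a (i + 1) ∘ dSet (Finset.Icc 1 i)

/-- Add 1 to the leftmost part equal to `j`; `none` if no part equals `j`. -/
def addAux (j : ℕ) : List ℕ → Option (List ℕ)
  | [] => none
  | x :: xs => if x = j then some ((x + 1) :: xs) else (addAux j xs).map (x :: ·)

/-- The box adding operator `𝔱ᵢ`: `𝔱₁` prepends a part 1, and for `i ≥ 2`, `𝔱ᵢ`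
adds 1 to the leftmost part equal to `i - 1` (formal zero if there is none). -/
def t : ℕ → Option (List ℕ) → Option (List ℕ)
  | 0 => id
  | 1 => Option.map (fun l => 1 :: l)
  | i + 2 => fun o => o.bind (addAux (i + 1))

theorem removeAux_eq_none_iff {i : ℕ} {l : List ℕ} : removeAux i l = none ↔ i ∉ l := by
  induction l with
  | nil => simp [removeAux]
  | cons x xs ih =>
    cases h : removeAux i xs <;> simp_all [removeAux, eq_comm]

theorem mem_iff_of_removeAux_eq_some {i j : ℕ} (hij : j ≠ i) (hij' : j ≠ i - 1)
    {l l' : List ℕ} (h : removeAux i l = some l') : j ∈ l' ↔ j ∈ l := by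
  induction l generalizing l' with
  | nil => simp [removeAux] at h
  | cons x xs ih =>
    cases hx : removeAux i xs with
    | some ys =>
      simp only [removeAux, hx, Option.some.injEq] at h
      rw [← h, List.mem_cons, List.mem_cons, ih hx]
    | none =>
      by_cases hxi : x = i
      · simp only [removeAux, hx, hxi, if_true, Option.some.injEq] at h
        simp [← h, hxi, hij, hij']
      · simp [removeAux, hx, hxi] at h

theorem removeAux_bind_comm {i j : ℕ} (hij : i ≠ j) (hi : i ≠ j - 1) (hj : j ≠ i - 1)
    (l : List ℕ) :
    (removeAux j l).bind (removeAux i) = (removeAux i l).bind (removeAux j) := by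
  induction l with
  | nil => rfl
  | cons x xs ih =>
    have key : ∀ {m n : ℕ}, n ≠ m → n ≠ m - 1 → ∀ {ys : List ℕ}, removeAux m xs = some ys →
        (removeAux n ys = none ↔ removeAux n xs = none) := by
      intro m n h h' ys hys
      rw [removeAux_eq_none_iff, removeAux_eq_none_iff, mem_iff_of_removeAux_eq_some h h' hys]
    have ki := @key i j hij.symm hj
    have kj := @key j i hij hi
    clear key
    cases h : removeAux i xs with
    | none =>
      cases h' : removeAux j xs with
      | none =>
        by_cases hxi : x = i <;> by_cases hxj : x = j <;>
          simp [removeAux, h, h', hxi, hxj, hij, hij.symm, hi.symm, hj.symm]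
      | some zs =>
        have hz := (kj h').2 h
        by_cases hxi : x = i <;> simp [removeAux, h, h', hz, hxi]
    | some ys =>
      cases h' : removeAux j xs with
      | none =>
        have hy := (ki h).2 h'
        by_cases hxj : x = j <;> simp [removeAux, h, h', hy, hxj]
      | some zs =>
        rw [h, h', Option.bind_some, Option.bind_some] at ih
        have hy : removeAux j ys ≠ none := by simp [ki h, h']
        obtain ⟨ws, hw⟩ := Option.ne_none_iff_exists'.mp hy
        simp [removeAux, h, h', ih, hw]

/-- Lemma 2.9: `𝔡ᵢ 𝔡ⱼ = 𝔡ⱼ 𝔡ᵢ` for distinct positive integers with `|i - j| ≥ 2`. -/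
theorem d_comm_d (i j : ℕ) (hi : 1 ≤ i) (hj : 1 ≤ j) (hij : i ≠ j)
    (h2 : 2 ≤ ((i : ℤ) - (j : ℤ)).natAbs) (α : List ℕ) :
    d i (d j (some α)) = d j (d i (some α)) := by
  obtain ⟨i, rfl⟩ := Nat.exists_eq_succ_of_ne_zero (Nat.one_le_iff_ne_zero.mp hi)
  obtain ⟨j, rfl⟩ := Nat.exists_eq_succ_of_ne_zero (Nat.one_le_iff_ne_zero.mp hj)
  exact removeAux_bind_comm hij (by omega) (by omega) α

end CompOps
end

section
/- For distinct positive integers i ≠ j, the jdt operator 𝔲_i and the box removing operator 𝔡_j commute: 𝔲_i 𝔡_j = 𝔡_j 𝔲_i as operators on weak compositions. -/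
namespace CompOps

theorem removeAux_append_singleton (i x : ℕ) (l : List ℕ) :
    removeAux i (l ++ [x]) =
      if x = i then some (l ++ [i - 1]) else (removeAux i l).map (· ++ [x]) := by
  induction l with
  | nil => simp [removeAux]
  | cons y l ih =>
    rw [List.cons_append, removeAux, ih]
    by_cases hx : x = i
    · simp [hx]
    · rw [removeAux]
      cases removeAux i l with
      | none => by_cases hy : y = i <;> simp [hx, hy]
      | some l' => simp [hx]

@[simp]
theorem d_none (i : ℕ) : d i none = none := by
  cases i <;> rfl

theorem d_a_self {i : ℕ} (hi : i ≠ 0) (o : Option (List ℕ)) : d i (a i o) = a (i - 1) o := by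
  obtain ⟨i, rfl⟩ := Nat.exists_eq_succ_of_ne_zero hi
  cases o <;> simp [d, a, removeAux_append_singleton]

theorem d_a_of_ne {i x : ℕ} (h : x ≠ i) (o : Option (List ℕ)) : d i (a x o) = a x (d i o) := by
  cases i with
  | zero => rfl
  | succ i => cases o <;> simp [d, a, removeAux_append_singleton, h]

/-- To check a property of all elements of `Option (List ℕ)`, it suffices to check it on the formal
zero, on the empty composition, and to show that it is preserved by appending. -/
theorem a_induction {p : Option (List ℕ) → Prop} (zero : p none) (nil : p (some []))
    (append : ∀ x o, p o → p (a x o)) (o : Option (List ℕ)) : p o := by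
  cases o with
  | none => exact zero
  | some l =>
    induction l using List.reverseRecOn with
    | nil => exact nil
    | append_singleton l x ih => exact append x _ ih

theorem d_nil {i : ℕ} (hi : i ≠ 0) : d i (some []) = none := by
  obtain ⟨i, rfl⟩ := Nat.exists_eq_succ_of_ne_zero hi
  rfl

theorem d_comm {i j : ℕ} (hi : i ≠ 0) (hij : i + 2 ≤ j) (o : Option (List ℕ)) :
    d i (d j o) = d j (d i o) := by
  have hj : j ≠ 0 := by omega
  induction o using a_induction with
  | zero => simp
  | nil => simp [d_nil, hi, hj]
  | append x o ih =>
    by_cases hxi : x = i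
    · subst hxi
      rw [d_a_of_ne (by omega), d_a_self hi, d_a_self hi, d_a_of_ne (by omega)]
    by_cases hxj : x = j
    · subst hxj
      rw [d_a_of_ne hxi, d_a_self hj, d_a_self hj, d_a_of_ne (by omega)]
    simp only [d_a_of_ne hxi, d_a_of_ne hxj, ih]

theorem d_d_succ_d {i : ℕ} (hi : i ≠ 0) (o : Option (List ℕ)) :
    d i (d (i + 1) (d i o)) = d i (d i (d (i + 1) o)) := by
  induction o using a_induction with
  | zero => simp
  | nil => simp [d_nil, hi]
  | append x o ih =>
    by_cases hxi : x = i
    · subst hxi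
      rw [d_a_self hi, d_a_of_ne (by omega), d_a_of_ne (by omega), d_a_of_ne (by omega),
        d_a_self hi, d_a_of_ne (by omega)]
    by_cases hxj : x = i + 1
    · subst hxj
      rw [d_a_of_ne hxi, d_a_self (by omega), d_a_self (by omega), Nat.add_sub_cancel,
        d_a_self hi, d_a_self hi, d_a_of_ne (by omega)]
    simp only [d_a_of_ne hxi, d_a_of_ne hxj, ih]

theorem d_d_succ_d_succ {i : ℕ} (hi : i ≠ 0) (o : Option (List ℕ)) :
    d i (d (i + 1) (d (i + 1) o)) = d (i + 1) (d i (d (i + 1) o)) := by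
  induction o using a_induction with
  | zero => simp
  | nil => simp [d_nil]
  | append x o ih =>
    by_cases hxi : x = i
    · subst hxi
      rw [d_a_of_ne (by omega), d_a_of_ne (by omega), d_a_self hi, d_a_self hi,
        d_a_of_ne (by omega)]
    by_cases hxj : x = i + 1
    · subst hxj
      rw [d_a_self (by omega), Nat.add_sub_cancel, d_a_of_ne (by omega), d_a_self hi,
        d_a_self hi, d_a_of_ne (by omega)]
    simp only [d_a_of_ne hxi, d_a_of_ne hxj, ih]

theorem foldr_comp_apply {α β : Type*} (f : α → β → β) (l : List α) (g : β → β) (b : β) :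
    l.foldr (fun i h => f i ∘ h) g b = l.foldr f (g b) := by
  induction l with
  | nil => rfl
  | cons i l ih => simp [ih]

theorem dSet_Icc (n : ℕ) (o : Option (List ℕ)) :
    dSet (Finset.Icc 1 n) o = (List.range' 1 n).foldr d o := by
  have h : Finset.Icc 1 n = (List.range' 1 n).toFinset := by
    ext k
    simp only [Finset.mem_Icc, List.mem_toFinset, List.mem_range'_1]
    omega
  have hs : (Finset.Icc 1 n).sort (· ≤ ·) = List.range' 1 n := by
    rw [h, List.toFinset_sort (· ≤ ·) List.nodup_range']
    exact List.pairwise_le_range'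
  rw [dSet, hs, foldr_comp_apply, id]

theorem dSet_Icc_succ (n : ℕ) (o : Option (List ℕ)) :
    dSet (Finset.Icc 1 (n + 1)) o = dSet (Finset.Icc 1 n) (d (n + 1) o) := by
  simp [dSet_Icc, List.range'_concat, Nat.add_comm]

theorem dSet_Icc_comm_d (n j : ℕ) (hj : j ≠ 0) (hjn : j ≠ n + 1) (o : Option (List ℕ)) :
    dSet (Finset.Icc 1 n) (d j o) = d j (dSet (Finset.Icc 1 n) o) := by
  induction n using Nat.strong_induction_on generalizing j o with
  | _ n ih =>
    rcases n with _ | n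
    · simp only [dSet_Icc, List.range'_zero, List.foldr_nil]
    by_cases hn : j = n + 1
    · subst hn
      rcases n with _ | m
      · simp only [dSet_Icc, List.range'_one, List.foldr_cons, List.foldr_nil, Nat.zero_add]
      · rw [dSet_Icc_succ, dSet_Icc_succ, d_d_succ_d_succ (by omega),
          ih m (by omega) _ (by omega) (by omega), ← dSet_Icc_succ, ← dSet_Icc_succ]
    by_cases hm : j = n
    · subst hm
      obtain ⟨m, rfl⟩ := Nat.exists_eq_succ_of_ne_zero hj
      rw [dSet_Icc_succ, dSet_Icc_succ, d_d_succ_d hj, ← dSet_Icc_succ,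
        ih (m + 1) (by omega) _ hj (by omega), ← dSet_Icc_succ]
    have hc : d (n + 1) (d j o) = d j (d (n + 1) o) := by
      rcases Nat.lt_or_gt_of_ne hn with h | h
      · exact (d_comm hj (by omega) o).symm
      · exact d_comm (by omega) (by omega) o
    rw [dSet_Icc_succ, hc, ih n (by omega) j hj hn, ← dSet_Icc_succ]

/-- Lemma 2.12: `𝔲ᵢ 𝔡ⱼ = 𝔡ⱼ 𝔲ᵢ` for distinct positive integers `i ≠ j`. -/
theorem u_comm_d (i j : ℕ) (hi : 1 ≤ i) (hj : 1 ≤ j) (hij : i ≠ j) (α : List ℕ) :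
    u i (d j (some α)) = d j (u i (some α)) := by
  obtain ⟨n, rfl⟩ := Nat.exists_eq_succ_of_ne_zero (Nat.one_le_iff_ne_zero.mp hi)
  simp only [u, Function.comp_apply]
  rw [dSet_Icc_comm_d n j (by omega) (Ne.symm hij), d_a_of_ne hij]

end CompOps
end

section
/- Let α be a weak composition and i a positive integer. If i = 1: (1) if α has a part equal to 1, then 𝔡_1𝔱_1(α) = 𝔱_1𝔡_1(α) ≠ 0; (2) if α has no part equal to 1, then 𝔡_1𝔱_1(α) = α and 𝔱_1𝔡_1(α) = 0. If i ≥ 2: (1) if α has parts equal to both i and i−1, then 𝔡_i𝔱_i(α) = 𝔱_i𝔡_i(α) ≠ 0; (2) if α has a part equal to i but no part equal to i−1, then 𝔡_i𝔱_i(α) = 0 and 𝔱_i𝔡_i(α) = α; (3) if α has no part equal to i but has a part equal to i−1, then 𝔡_i𝔱_i(α) = α and 𝔱_i𝔡_i(α) = 0; (4) if α has parts equal to neither i nor i−1, then 𝔡_i𝔱_i(α) = 𝔱_i𝔡_i(α) = 0. In particular, whenever 𝔡_i𝔱_i(α) and 𝔱_i𝔡_i(α) are both nonzero, they are equal. -/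
namespace CompOps

theorem addAux_eq_none_iff {j : ℕ} {l : List ℕ} : addAux j l = none ↔ j ∉ l := by
  induction l with
  | nil => simp [addAux]
  | cons x xs ih => cases h : addAux j xs <;> grind [addAux]

/-- Removing a box undoes adding one when the added box creates the only part `k + 1`. -/
theorem removeAux_of_addAux {k : ℕ} {l m : List ℕ} (hl : k + 1 ∉ l)
    (h : addAux k l = some m) : removeAux (k + 1) m = some l := by
  induction l generalizing m with
  | nil => simp [addAux] at h
  | cons x xs ih => cases h' : addAux k xs <;>
    grind [addAux, removeAux, removeAux_eq_none_iff]

/-- Adding a box undoes removing one when the removed box creates the only part `k`. -/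
theorem addAux_of_removeAux {k : ℕ} {l m : List ℕ} (hl : k ∉ l)
    (h : removeAux (k + 1) l = some m) : addAux k m = some l := by
  induction l generalizing m with
  | nil => simp [removeAux] at h
  | cons x xs ih => grind [addAux, removeAux]

/-- If both parts `k + 1` and `k` occur, then adding and removing a box commute. -/
theorem exists_removeAux_addAux_comm {k : ℕ} {l m n : List ℕ}
    (hm : addAux k l = some m) (hn : removeAux (k + 1) l = some n) :
    ∃ p, removeAux (k + 1) m = some p ∧ addAux k n = some p := by
  induction l generalizing m n with
  | nil => simp [addAux] at hm
  | cons x xs ih =>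
    have ha := @removeAux_of_addAux k xs
    have hr := removeAux_eq_none_iff (i := k + 1) (l := xs)
    cases h : addAux k xs <;> cases h' : removeAux (k + 1) xs <;> grind [addAux, removeAux]

/-- Lemma 2.15: case analysis for `𝔡ᵢ 𝔱ᵢ` versus `𝔱ᵢ 𝔡ᵢ` on a weak composition `α`.
(Equalities claimed at the level of weak compositions, except `𝔡₁𝔱₁(α) = α` in the
case that `α` has no part equal to `1`, where, following the paper's convention that
parts equal to `0` are ignored, the equality is of underlying compositions.) -/
theorem dt_td_cases (α : List ℕ) (i : ℕ) (hi : 1 ≤ i) :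
    (i = 1 →
      ((1 ∈ α →
          d 1 (t 1 (some α)) = t 1 (d 1 (some α)) ∧ d 1 (t 1 (some α)) ≠ none) ∧
       (1 ∉ α →
          (d 1 (t 1 (some α))).map (List.filter (fun x => 0 < x)) =
              some (α.filter (fun x => 0 < x)) ∧
            t 1 (d 1 (some α)) = none))) ∧
    (2 ≤ i →
      ((i ∈ α → i - 1 ∈ α →
          d i (t i (some α)) = t i (d i (some α)) ∧ d i (t i (some α)) ≠ none) ∧
       (i ∈ α → i - 1 ∉ α →
          d i (t i (some α)) = none ∧ t i (d i (some α)) = some α) ∧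
       (i ∉ α → i - 1 ∈ α →
          d i (t i (some α)) = some α ∧ t i (d i (some α)) = none) ∧
       (i ∉ α → i - 1 ∉ α →
          d i (t i (some α)) = none ∧ t i (d i (some α)) = none))) ∧
    (d i (t i (some α)) ≠ none → t i (d i (some α)) ≠ none →
      d i (t i (some α)) = t i (d i (some α))) := by
  have none_d {l : List ℕ} {k : ℕ} (h : k + 1 ∉ l) : d (k + 1) (some l) = none :=
    removeAux_eq_none_iff.mpr h
  obtain rfl | h2 := hi.eq_or_lt
  · have h1 (h : 1 ∉ α) : t 1 (d 1 (some α)) = none := by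
      rw [none_d h]; rfl
    have h0 (h : 1 ∈ α) :
        d 1 (t 1 (some α)) = t 1 (d 1 (some α)) ∧ d 1 (t 1 (some α)) ≠ none := by
      obtain ⟨m, hm⟩ := Option.ne_none_iff_exists'.mp
        (mt removeAux_eq_none_iff.mp (not_not.mpr h))
      simp [d, t, removeAux, hm]
    refine ⟨fun _ => ⟨h0, fun h => ⟨?_, h1 h⟩⟩, by omega, fun _ h => ?_⟩
    · simp [d, t, removeAux, removeAux_eq_none_iff.mpr h]
    · exact (h0 (by by_contra h'; exact h (h1 h'))).1
  · obtain ⟨k, rfl⟩ := Nat.exists_eq_add_of_le' h2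
    have hr := removeAux_eq_none_iff (i := k + 2) (l := α)
    have ha := addAux_eq_none_iff (j := k + 1) (l := α)
    simp only [d, t, Option.bind_some, Nat.succ_eq_add_one,
      show k + 2 - 1 = k + 1 from rfl]
    cases hm : addAux (k + 1) α <;> cases hn : removeAux (k + 2) α
    · simp_all
    · have := addAux_of_removeAux (ha.mp hm) hn
      simp_all
    · have := removeAux_of_addAux (hr.mp hn) hm
      simp_all
    · obtain ⟨p, hp, hq⟩ := exists_removeAux_addAux_comm hm hn
      simp_all

end CompOps
end

section
/- Let α be a composition, I a finite set of positive integers and i ∈ I such that 𝔱_i 𝔡_I(α) ≠ 0, and write I = A ⊔ {i} ⊔ B with A = {j ∈ I : j < i} and B = {j ∈ I : j > i}. Then the largest part of α that is strictly less than i is at least max(A) (where max of the empty set is 0); in particular, if A ≠ ∅ then α has a part strictly less than i. -/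
namespace CompOps

/-- Removing a box from a part `i + 1` turns one part `i + 1` into a part `i`. -/
theorem count_removeAux {i : ℕ} {l m : List ℕ} (h : removeAux (i + 1) l = some m) (k : ℕ) :
    m.count k + (if k = i + 1 then 1 else 0) = l.count k + (if k = i then 1 else 0) := by
  induction l generalizing m with
  | nil => simp [removeAux] at h
  | cons x xs ih =>
    rw [removeAux] at h
    split at h
    · next ys hys =>
      obtain rfl := Option.some.inj h
      have := ih hys
      simp only [List.count_cons]
      omega
    · split_ifs at h with hxi
      obtain rfl := Option.some.inj h
      subst hxi
      simp only [List.count_cons, beq_iff_eq, Nat.add_sub_cancel, eq_comm (a := k)]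
      omega

theorem count_foldr_d {L : List ℕ} (hL : L.Nodup) (hpos : ∀ j ∈ L, 0 < j) {l m : List ℕ}
    (h : L.foldr (fun i f => d i ∘ f) id (some l) = some m) (k : ℕ) :
    m.count k + (if k ∈ L then 1 else 0) = l.count k + (if k + 1 ∈ L then 1 else 0) := by
  induction L generalizing m with
  | nil => simp_all
  | cons j L ih =>
    obtain ⟨i, rfl⟩ := Nat.exists_eq_succ_of_ne_zero (hpos j (by simp)).ne'
    rw [List.nodup_cons] at hL
    obtain ⟨n, hn, hm⟩ := Option.bind_eq_some_iff.mp h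
    have h₁ := ih hL.2 (fun j hj => hpos j (by simp [hj])) hn
    have h₂ := count_removeAux hm k
    have h₃ := hL.1
    simp only [List.mem_cons, Nat.succ_eq_add_one, Nat.add_right_cancel_iff] at *
    grind

/-- `𝔡_I` changes the number of parts equal to `k` by `[k + 1 ∈ I] - [k ∈ I]`. -/
theorem count_dSet {I : Finset ℕ} (hI : ∀ j ∈ I, 0 < j) {l m : List ℕ}
    (h : dSet I (some l) = some m) (k : ℕ) :
    m.count k + (if k ∈ I then 1 else 0) = l.count k + (if k + 1 ∈ I then 1 else 0) := by
  simpa using count_foldr_d (I.sort_nodup (· ≤ ·)) (by simpa using hI) h k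

theorem mem_of_addAux_ne_none {j : ℕ} {l : List ℕ} (h : addAux j l ≠ none) : j ∈ l := by
  induction l with
  | nil => simp [addAux] at h
  | cons x xs ih =>
    rw [addAux] at h
    split_ifs at h with hx
    · simp [hx]
    · exact List.mem_cons_of_mem _ (ih fun h' => h (by simp [h']))

theorem le_foldr_max {l : List ℕ} {p : ℕ} (hp : p ∈ l) : p ≤ l.foldr max 0 := by
  induction l with
  | nil => simp at hp
  | cons x xs ih =>
    rcases List.mem_cons.mp hp with rfl | hp
    · exact le_max_left _ _
    · exact (ih hp).trans (le_max_right _ _)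

theorem exists_part_of_t_dSet_ne_none {α : List ℕ} {I : Finset ℕ} (hI : ∀ j ∈ I, 0 < j) {i : ℕ}
    (hw : t i (dSet I (some α)) ≠ none) {j : ℕ} (hj : j ∈ I) (hji : j < i) :
    ∃ p ∈ α, j ≤ p ∧ p < i := by
  obtain ⟨m, hm, hmax⟩ := (I.filter (· < i)).exists_max_image id ⟨j, by simp [hj, hji]⟩
  obtain ⟨hmI, hmi⟩ := Finset.mem_filter.mp hm
  refine ⟨m, ?_, hmax j (by simp [hj, hji]), hmi⟩
  obtain ⟨i, rfl⟩ : ∃ n, i = n + 2 := ⟨i - 2, by have := hI j hj; omega⟩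
  obtain ⟨γ, hγ⟩ : ∃ γ, dSet I (some α) = some γ := by
    refine Option.ne_none_iff_exists'.mp fun h => hw ?_
    simp [h, t]
  have hcount := count_dSet hI hγ m
  rw [← List.count_pos_iff]
  rw [if_pos hmI] at hcount
  by_cases hm' : m = i + 1
  · subst hm'
    have : i + 1 ∈ γ := mem_of_addAux_ne_none (by simpa [hγ, t] using hw)
    have := List.count_pos_iff.mpr this
    split_ifs at hcount <;> omega
  · have : m + 1 ∉ I := fun h => by
      have : m + 1 ≤ m := hmax (m + 1) (Finset.mem_filter.mpr ⟨h, by omega⟩)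
      omega
    rw [if_neg this] at hcount
    omega

/-- If `i ∈ I` and `𝔱ᵢ 𝔡_I (α) ≠ 0` for a composition `α` and a finite set `I` of
positive integers, then the largest part of `α` strictly less than `i` (interpreted
as `0` if there is none) is at least `max(A)` where `A = {j ∈ I : j < i}`; in
particular, if `A ≠ ∅` then `α` has a part strictly less than `i`. -/
theorem largest_part_ge_maxA (α : List ℕ) (hα : ∀ x ∈ α, 0 < x)
    (I : Finset ℕ) (hI : ∀ j ∈ I, 0 < j) (i : ℕ) (hi : i ∈ I)
    (hw : t i (dSet I (some α)) ≠ none) :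
    (∀ j ∈ I, j < i → j ≤ (α.filter (fun p => p < i)).foldr max 0) ∧
    ((I.filter (fun j => j < i)).Nonempty → ∃ p ∈ α, p < i) := by
  constructor
  · intro j hj hji
    obtain ⟨p, hp, hjp, hpi⟩ := exists_part_of_t_dSet_ne_none hI hw hj hji
    exact hjp.trans (le_foldr_max (List.mem_filter.mpr ⟨hp, by simpa using hpi⟩))
  · rintro ⟨j, hj⟩
    obtain ⟨hj, hji⟩ := Finset.mem_filter.mp hj
    obtain ⟨p, hp, -, hpi⟩ := exists_part_of_t_dSet_ne_none hI hw hj hji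
    exact ⟨p, hp, hpi⟩

end CompOps
end
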